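/- Let f and g be finite linear combinations of Wilson Haar functions on ℝ^d. Then for every dyadic cube J ∈ 𝒟 and every β ∈ Γ_d, the Haar coefficient of the product fg satisfies the product formula: (fg)^(J,β) = ∑_{I: I⊆J} ∑_{α: E_{α,I} ⊊ E_{β,J}} f̂(I,α) ĝ(I,α) ⟨h¹_{E_{α,I}}, h_J^β⟩_{L²} + f̂(J,β) ⟨g⟩_{E_{β,J}} + ĝ(J,β) ⟨f⟩_{E_{β,J}}. -/

import Mathlib

open MeasureTheory

noncomputable section

/-- A dyadic cube in `ℝ^d`: the cube `∏ᵢ [mᵢ 2^k, (mᵢ+1) 2^k)`. -/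
structure DyadicCube (d : ℕ) where
  k : ℤ
  m : Fin d → ℤ
deriving DecidableEq

namespace DyadicCube

/-- The underlying set of a dyadic cube. -/
def toSet {d : ℕ} (I : DyadicCube d) : Set (Fin d → ℝ) :=
  {x | ∀ i, (I.m i : ℝ) * (2 : ℝ) ^ I.k ≤ x i ∧ x i < ((I.m i : ℝ) + 1) * (2 : ℝ) ^ I.k}

/-- `J` is a dyadic child of `I`. -/
def IsChild {d : ℕ} (J I : DyadicCube d) : Prop :=
  J.k + 1 = I.k ∧ J.toSet ⊆ I.toSet

end DyadicCube

/-- The index set `Γ_d = {0,1}^d \ {(1,…,1)}`. -/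
def Gamma (d : ℕ) : Type := {v : Fin d → Bool // v ≠ fun _ => true}

instance {d : ℕ} : DecidableEq (Gamma d) := Subtype.instDecidableEq

/-- The average `⟨f⟩_E` of `f` over a set `E`. -/
def avg {d : ℕ} (E : Set (Fin d → ℝ)) (f : (Fin d → ℝ) → ℝ) : ℝ :=
  (∫ x in E, f x) / (volume E).toReal

/-- An axis-parallel cube with corner `c` and side length `r`. -/
def Cube {d : ℕ} (c : Fin d → ℝ) (r : ℝ) : Set (Fin d → ℝ) :=
  {x | ∀ i, c i ≤ x i ∧ x i < c i + r}

/-- `A` is an upper bound for the `A₂` characteristic of `w`: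
`⟨w⟩_I ⟨w⁻¹⟩_I ≤ A` for every cube `I`. -/
def IsA2Bound {d : ℕ} (w : (Fin d → ℝ) → ℝ) (A : ℝ) : Prop :=
  ∀ (c : Fin d → ℝ) (r : ℝ), 0 < r →
    avg (Cube c r) w * avg (Cube c r) (fun x => (w x)⁻¹) ≤ A

/-- A weight: a positive, measurable, locally integrable function (with locally
integrable reciprocal). -/
def IsWeight {d : ℕ} (w : (Fin d → ℝ) → ℝ) : Prop :=
  (∀ x, 0 < w x) ∧ Measurable w ∧ LocallyIntegrable w volume ∧
    LocallyIntegrable (fun x => (w x)⁻¹) volume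

/-- The `L¹`-normalized indicator `h¹_E = 1_E / |E|`. -/
def h1 {d : ℕ} (E : Set (Fin d → ℝ)) : (Fin d → ℝ) → ℝ :=
  fun x => ((volume E).toReal)⁻¹ * E.indicator (fun _ => (1 : ℝ)) x

/-- Wilson's system of pairs of sets `(E¹_{α,I}, E²_{α,I})` indexed by dyadic cubes
`I` and `α ∈ Γ_d`. -/
structure WilsonSystem (d : ℕ) where
  E1 : DyadicCube d → Gamma d → Set (Fin d → ℝ)
  E2 : DyadicCube d → Gamma d → Set (Fin d → ℝ)
  childUnion1 : ∀ I α, ∃ S : Finset (DyadicCube d), S.Nonempty ∧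
    (∀ J ∈ S, J.IsChild I) ∧ E1 I α = ⋃ J ∈ S, J.toSet
  childUnion2 : ∀ I α, ∃ S : Finset (DyadicCube d), S.Nonempty ∧
    (∀ J ∈ S, J.IsChild I) ∧ E2 I α = ⋃ J ∈ S, J.toSet
  measEq : ∀ I α, volume (E1 I α) = volume (E2 I α)
  disj : ∀ I α, Disjoint (E1 I α) (E2 I α)
  nestedOrDisjoint : ∀ I α J β, (I, α) ≠ (J, β) →
    (E1 I α ∪ E2 I α) ⊆ E1 J β ∨ (E1 I α ∪ E2 I α) ⊆ E2 J β ∨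
    (E1 J β ∪ E2 J β) ⊆ E1 I α ∨ (E1 J β ∪ E2 J β) ⊆ E2 I α ∨
    Disjoint (E1 I α ∪ E2 I α) (E1 J β ∪ E2 J β)

namespace WilsonSystem

variable {d : ℕ}

/-- `E_{α,I} = E¹_{α,I} ∪ E²_{α,I}`. -/
def E (W : WilsonSystem d) (I : DyadicCube d) (α : Gamma d) : Set (Fin d → ℝ) :=
  W.E1 I α ∪ W.E2 I α

/-- The Wilson Haar function `h_I^α = |E_{α,I}|^{-1/2} (1_{E²_{α,I}} - 1_{E¹_{α,I}})`. -/
def haar (W : WilsonSystem d) (I : DyadicCube d) (α : Gamma d) : (Fin d → ℝ) → ℝ :=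
  fun x => (Real.sqrt (volume (W.E I α)).toReal)⁻¹ *
    ((W.E2 I α).indicator (fun _ => (1 : ℝ)) x - (W.E1 I α).indicator (fun _ => (1 : ℝ)) x)

/-- The Haar coefficient `f̂(I,α) = ⟨f, h_I^α⟩_{L²}`. -/
def hcoef (W : WilsonSystem d) (f : (Fin d → ℝ) → ℝ) (I : DyadicCube d) (α : Gamma d) : ℝ :=
  ∫ x, f x * W.haar I α x

/-- The weighted Wilson Haar function `h_I^{w,α}`. -/
def haarW (W : WilsonSystem d) (w : (Fin d → ℝ) → ℝ) (I : DyadicCube d) (α : Gamma d) :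
    (Fin d → ℝ) → ℝ :=
  fun x => (Real.sqrt (∫ y in W.E I α, w y))⁻¹ *
    (Real.sqrt ((∫ y in W.E1 I α, w y) / (∫ y in W.E2 I α, w y)) *
        (W.E2 I α).indicator (fun _ => (1 : ℝ)) x -
      Real.sqrt ((∫ y in W.E2 I α, w y) / (∫ y in W.E1 I α, w y)) *
        (W.E1 I α).indicator (fun _ => (1 : ℝ)) x)

/-- The Haar multiplier `T_σ f = ∑_{I,α} σ_{I,α} f̂(I,α) h_I^α`. -/
def Tmult (W : WilsonSystem d) (σ : DyadicCube d → Gamma d → ℝ) (f : (Fin d → ℝ) → ℝ) :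
    (Fin d → ℝ) → ℝ :=
  fun x => ∑' p : DyadicCube d × Gamma d, σ p.1 p.2 * W.hcoef f p.1 p.2 * W.haar p.1 p.2 x

/-- The paraproduct `P_a^{(0,0)} f = ∑_{I,α} a_{I,α} f̂(I,α) h_I^α`. -/
def P00 (W : WilsonSystem d) (a : DyadicCube d → Gamma d → ℝ) (f : (Fin d → ℝ) → ℝ) :
    (Fin d → ℝ) → ℝ :=
  fun x => ∑' p : DyadicCube d × Gamma d, a p.1 p.2 * W.hcoef f p.1 p.2 * W.haar p.1 p.2 x

/-- The paraproduct `P_a^{(0,1)} f = ∑_{I,α} a_{I,α} ⟨f⟩_{E_{α,I}} h_I^α`. -/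
def P01 (W : WilsonSystem d) (a : DyadicCube d → Gamma d → ℝ) (f : (Fin d → ℝ) → ℝ) :
    (Fin d → ℝ) → ℝ :=
  fun x => ∑' p : DyadicCube d × Gamma d, a p.1 p.2 * avg (W.E p.1 p.2) f * W.haar p.1 p.2 x

/-- The paraproduct `P_a^{(1,0)} f = ∑_{I,α} a_{I,α} f̂(I,α) h¹_{E_{α,I}}`. -/
def P10 (W : WilsonSystem d) (a : DyadicCube d → Gamma d → ℝ) (f : (Fin d → ℝ) → ℝ) :
    (Fin d → ℝ) → ℝ :=
  fun x => ∑' p : DyadicCube d × Gamma d, a p.1 p.2 * W.hcoef f p.1 p.2 * h1 (W.E p.1 p.2) x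

/-- The dyadic square function
`S f(x) = (∑_{I,α} |f̂(I,α)|² 1_I(x)/|I|)^{1/2}`. -/
def sqFn (W : WilsonSystem d) (f : (Fin d → ℝ) → ℝ) : (Fin d → ℝ) → ℝ :=
  fun x => Real.sqrt (∑' p : DyadicCube d × Gamma d,
    (W.hcoef f p.1 p.2) ^ 2 * p.1.toSet.indicator (fun _ => (1 : ℝ)) x /
      (volume p.1.toSet).toReal)

/-- The canonical paraproduct of type `ε` built from the function `g`:
`ε = 0` gives `P^{(0,1)}_{ĝ}`, `ε = 1` gives `P^{(1,0)}_{ĝ}`, and `ε = 2` gives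
`P^{(0,0)}_{⟨g⟩}`. -/
def paraOf (W : WilsonSystem d) (g : (Fin d → ℝ) → ℝ) (ε : Fin 3) :
    ((Fin d → ℝ) → ℝ) → ((Fin d → ℝ) → ℝ) :=
  if ε = 0 then W.P01 (fun I α => W.hcoef g I α)
  else if ε = 1 then W.P10 (fun I α => W.hcoef g I α)
  else W.P00 (fun I α => avg (W.E I α) g)

end WilsonSystem

/-- The weighted measure `w(x) dx` on `ℝ^d`. -/
def wMeasure {d : ℕ} (w : (Fin d → ℝ) → ℝ) : Measure (Fin d → ℝ) :=
  volume.withDensity fun x => ENNReal.ofReal (w x)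


namespace DyadicCube

variable {d : ℕ}

lemma toSet_eq_pi (I : DyadicCube d) : I.toSet = Set.univ.pi fun i =>
    Set.Ico ((I.m i : ℝ) * (2 : ℝ) ^ I.k) (((I.m i : ℝ) + 1) * (2 : ℝ) ^ I.k) := by
  ext x
  simp [toSet, Set.mem_pi]

lemma measurableSet_toSet (I : DyadicCube d) : MeasurableSet I.toSet := by
  rw [toSet_eq_pi]
  exact MeasurableSet.univ_pi fun i => measurableSet_Ico

lemma volume_toSet (I : DyadicCube d) :
    volume I.toSet = ∏ _i : Fin d, ENNReal.ofReal ((2 : ℝ) ^ I.k) := by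
  rw [toSet_eq_pi, volume_pi_pi]
  refine Finset.prod_congr rfl fun i _ => ?_
  rw [Real.volume_Ico]
  congr 1
  ring

lemma volume_toSet_ne_top (I : DyadicCube d) : volume I.toSet ≠ ⊤ := by
  rw [volume_toSet]
  exact ENNReal.prod_ne_top fun i _ => ENNReal.ofReal_ne_top

lemma volume_toSet_ne_zero (I : DyadicCube d) : volume I.toSet ≠ 0 := by
  rw [volume_toSet, Finset.prod_ne_zero_iff]
  intro i _
  have : (0 : ℝ) < (2 : ℝ) ^ I.k := by positivity
  simpa using this

lemma toSet_nonempty (I : DyadicCube d) : I.toSet.Nonempty := by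
  by_contra h
  rw [Set.not_nonempty_iff_eq_empty] at h
  exact I.volume_toSet_ne_zero (by simp [h])

/-- Intersecting dyadic cubes are nested. -/
lemma toSet_subset_of_mem {K L : DyadicCube d} (hk : K.k ≤ L.k) {x : Fin d → ℝ}
    (hxK : x ∈ K.toSet) (hxL : x ∈ L.toSet) : K.toSet ⊆ L.toSet := by
  obtain ⟨n, hn⟩ := Int.eq_ofNat_of_zero_le (sub_nonneg.mpr hk)
  have hL : (2 : ℝ) ^ L.k = 2 ^ n * (2 : ℝ) ^ K.k := by
    have : L.k = (n : ℤ) + K.k := by omega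
    rw [this, zpow_add₀ (by norm_num), zpow_natCast]
  have hpos : (0 : ℝ) < (2 : ℝ) ^ K.k := by positivity
  intro y hy i
  obtain ⟨a1, a2⟩ := hxK i
  obtain ⟨b1, b2⟩ := hxL i
  obtain ⟨y1, y2⟩ := hy i
  rw [hL, ← mul_assoc] at b1 b2 ⊢
  rw [← mul_assoc]
  have e1 : (L.m i : ℝ) * 2 ^ n < (K.m i : ℝ) + 1 :=
    lt_of_mul_lt_mul_right (b1.trans_lt a2) hpos.le
  have e2 : (K.m i : ℝ) < ((L.m i : ℝ) + 1) * 2 ^ n :=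
    lt_of_mul_lt_mul_right (a1.trans_lt b2) hpos.le
  have e1' : L.m i * 2 ^ n ≤ K.m i := by
    have : L.m i * 2 ^ n < K.m i + 1 := by exact_mod_cast e1
    omega
  have e2' : K.m i + 1 ≤ (L.m i + 1) * 2 ^ n := by
    have : K.m i < (L.m i + 1) * 2 ^ n := by exact_mod_cast e2
    omega
  have f1 : (L.m i : ℝ) * 2 ^ n ≤ (K.m i : ℝ) := by exact_mod_cast e1'
  have f2 : (K.m i : ℝ) + 1 ≤ ((L.m i : ℝ) + 1) * 2 ^ n := by exact_mod_cast e2'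
  exact ⟨(mul_le_mul_of_nonneg_right f1 hpos.le).trans y1,
    y2.trans_le (mul_le_mul_of_nonneg_right f2 hpos.le)⟩

lemma union_meas (S : Finset (DyadicCube d)) : MeasurableSet (⋃ J ∈ S, J.toSet) :=
  S.measurableSet_biUnion fun J _ => J.measurableSet_toSet

lemma union_ne_top (S : Finset (DyadicCube d)) : volume (⋃ J ∈ S, J.toSet) ≠ ⊤ := by
  refine ne_top_of_le_ne_top ?_ (measure_biUnion_finset_le S _)
  exact ENNReal.sum_ne_top.mpr fun J _ => J.volume_toSet_ne_top

end DyadicCube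

namespace WilsonSystem

variable {d : ℕ} (W : WilsonSystem d)

lemma meas1 (I α) : MeasurableSet (W.E1 I α) := by
  obtain ⟨S, -, -, h⟩ := W.childUnion1 I α
  rw [h]; exact DyadicCube.union_meas S

lemma meas2 (I α) : MeasurableSet (W.E2 I α) := by
  obtain ⟨S, -, -, h⟩ := W.childUnion2 I α
  rw [h]; exact DyadicCube.union_meas S

lemma measE (I α) : MeasurableSet (W.E I α) := (W.meas1 I α).union (W.meas2 I α)

lemma top1 (I α) : volume (W.E1 I α) ≠ ⊤ := by
  obtain ⟨S, -, -, h⟩ := W.childUnion1 I α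
  rw [h]; exact DyadicCube.union_ne_top S

lemma top2 (I α) : volume (W.E2 I α) ≠ ⊤ := W.measEq I α ▸ W.top1 I α

lemma topE (I α) : volume (W.E I α) ≠ ⊤ := by
  have := measure_union_le (μ := volume) (W.E1 I α) (W.E2 I α)
  exact ne_top_of_le_ne_top (ENNReal.add_ne_top.mpr ⟨W.top1 I α, W.top2 I α⟩) this

lemma exists_child1 (I α) : ∃ C : DyadicCube d, C.IsChild I ∧ C.toSet ⊆ W.E1 I α := by
  obtain ⟨S, ⟨C, hC⟩, hS, h⟩ := W.childUnion1 I α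
  exact ⟨C, hS C hC, h ▸ Set.subset_biUnion_of_mem (u := fun J : DyadicCube d => J.toSet) hC⟩

lemma exists_child2 (I α) : ∃ C : DyadicCube d, C.IsChild I ∧ C.toSet ⊆ W.E2 I α := by
  obtain ⟨S, ⟨C, hC⟩, hS, h⟩ := W.childUnion2 I α
  exact ⟨C, hS C hC, h ▸ Set.subset_biUnion_of_mem (u := fun J : DyadicCube d => J.toSet) hC⟩

lemma E_subset (I α) : W.E I α ⊆ I.toSet := by
  obtain ⟨S, -, hS, h⟩ := W.childUnion1 I α
  obtain ⟨T, -, hT, h'⟩ := W.childUnion2 I α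
  unfold E
  rw [h, h']
  exact Set.union_subset (Set.iUnion₂_subset fun J hJ => (hS J hJ).2)
    (Set.iUnion₂_subset fun J hJ => (hT J hJ).2)

/-- The real measure of `E¹`. -/
def v (I : DyadicCube d) (α : Gamma d) : ℝ := (volume (W.E1 I α)).toReal

lemma v_pos (I α) : 0 < W.v I α := by
  obtain ⟨C, -, hC⟩ := W.exists_child1 I α
  refine ENNReal.toReal_pos ?_ (W.top1 I α)
  intro h0
  exact C.volume_toSet_ne_zero (measure_mono_null hC h0)

lemma v_eq2 (I α) : (volume (W.E2 I α)).toReal = W.v I α := by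
  rw [v, W.measEq I α]

lemma volE (I α) : (volume (W.E I α)).toReal = 2 * W.v I α := by
  rw [E, measure_union (W.disj I α) (W.meas2 I α), ENNReal.toReal_add (W.top1 I α) (W.top2 I α),
    v_eq2, v]
  ring

/-- Strict containment of the sets gives containment of the cubes. -/
lemma cube_subset {I J : DyadicCube d} {α : Gamma d} (h : W.E I α ⊆ J.toSet) :
    I.toSet ⊆ J.toSet := by
  obtain ⟨C, hC, hC1⟩ := W.exists_child1 I α
  obtain ⟨D, hD, hD2⟩ := W.exists_child2 I α
  obtain ⟨x, hx⟩ := C.toSet_nonempty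
  obtain ⟨y, hy⟩ := D.toSet_nonempty
  have hxJ : x ∈ J.toSet := h (Or.inl (hC1 hx))
  have hyJ : y ∈ J.toSet := h (Or.inr (hD2 hy))
  by_cases hk : I.k ≤ J.k
  · exact DyadicCube.toSet_subset_of_mem hk (hC.2 hx) hxJ
  · exfalso
    have h1 := hC.1
    have h2 := hD.1
    have s1 : J.toSet ⊆ C.toSet := DyadicCube.toSet_subset_of_mem (by omega) hxJ hx
    exact Set.disjoint_left.mp (W.disj I α) (hC1 (s1 hyJ)) (hD2 hy)

lemma haar_off {I α} {x} (hx : x ∉ W.E I α) : W.haar I α x = 0 := by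
  have h1 : x ∉ W.E1 I α := fun h => hx (Or.inl h)
  have h2 : x ∉ W.E2 I α := fun h => hx (Or.inr h)
  simp [haar, h1, h2]

lemma haar_on1 {I α} {x} (hx : x ∈ W.E1 I α) :
    W.haar I α x = -(Real.sqrt (volume (W.E I α)).toReal)⁻¹ := by
  have h2 : x ∉ W.E2 I α := Set.disjoint_left.mp (W.disj I α) hx
  simp [haar, hx, h2]

lemma haar_on2 {I α} {x} (hx : x ∈ W.E2 I α) :
    W.haar I α x = (Real.sqrt (volume (W.E I α)).toReal)⁻¹ := by
  have h2 : x ∉ W.E1 I α := Set.disjoint_right.mp (W.disj I α) hx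
  simp [haar, hx, h2]

lemma haar_sq (I α) (x) : W.haar I α x * W.haar I α x = h1 (W.E I α) x := by
  have hs : (Real.sqrt (volume (W.E I α)).toReal)⁻¹ * (Real.sqrt (volume (W.E I α)).toReal)⁻¹
      = ((volume (W.E I α)).toReal)⁻¹ := by
    rw [← mul_inv, Real.mul_self_sqrt ENNReal.toReal_nonneg]
  by_cases hx : x ∈ W.E I α
  · have hr : h1 (W.E I α) x = ((volume (W.E I α)).toReal)⁻¹ := by simp [h1, hx]
    rw [hr, ← hs]
    rcases hx with hx | hx
    · rw [W.haar_on1 hx]; ring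
    · rw [W.haar_on2 hx]
  · rw [W.haar_off hx]; simp [h1, hx]

lemma haar_int (I α) : Integrable (W.haar I α) := by
  unfold haar
  refine Integrable.const_mul (Integrable.sub ?_ ?_) _
  · exact (integrable_indicator_iff (W.meas2 I α)).mpr (integrableOn_const (W.top2 I α))
  · exact (integrable_indicator_iff (W.meas1 I α)).mpr (integrableOn_const (W.top1 I α))

lemma haar_bdd (I α) (x) : ‖W.haar I α x‖ ≤ (Real.sqrt (volume (W.E I α)).toReal)⁻¹ := by
  have h0 : 0 ≤ (Real.sqrt (volume (W.E I α)).toReal)⁻¹ := by positivity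
  by_cases hx : x ∈ W.E I α
  · rcases hx with hx | hx
    · rw [W.haar_on1 hx, norm_neg, Real.norm_of_nonneg h0]
    · rw [W.haar_on2 hx, Real.norm_of_nonneg h0]
  · rw [W.haar_off hx, norm_zero]; exact h0

lemma int_mul_haar {f : (Fin d → ℝ) → ℝ} (hf : Integrable f) (I α) :
    Integrable fun x => f x * W.haar I α x :=
  hf.mul_bdd (W.haar_int I α).aestronglyMeasurable
    (Filter.Eventually.of_forall (W.haar_bdd I α))

lemma integral_haar (I α) : ∫ x, W.haar I α x = 0 := by
  unfold haar
  rw [integral_const_mul, integral_sub, integral_indicator (W.meas2 I α),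
    integral_indicator (W.meas1 I α)]
  · simp [Measure.real, W.measEq I α]
  · exact (integrable_indicator_iff (W.meas2 I α)).mpr (integrableOn_const (W.top2 I α))
  · exact (integrable_indicator_iff (W.meas1 I α)).mpr (integrableOn_const (W.top1 I α))

lemma integral_h1 (I α) : ∫ x, h1 (W.E I α) x = 1 := by
  unfold h1
  rw [integral_const_mul, integral_indicator (W.measE I α)]
  have h : (volume (W.E I α)).toReal ≠ 0 := by
    rw [volE]; have := W.v_pos I α; positivity
  simp [Measure.real, h]

/-- A function constant on `E` is orthogonal to the Haar function. -/
lemma integral_const_on {f : (Fin d → ℝ) → ℝ} {I α} {c : ℝ} (hf : ∀ x ∈ W.E I α, f x = c) :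
    ∫ x, f x * W.haar I α x = 0 := by
  have : (fun x => f x * W.haar I α x) = fun x => c * W.haar I α x := by
    funext x
    by_cases hx : x ∈ W.E I α
    · rw [hf x hx]
    · rw [W.haar_off hx]; simp
  rw [this, integral_const_mul, integral_haar, mul_zero]

lemma const_on_of_le {I J : DyadicCube d} {α β : Gamma d} (hne : (I, α) ≠ (J, β))
    (hv : W.v I α ≤ W.v J β) : ∃ c, ∀ x ∈ W.E I α, W.haar J β x = c := by
  have hp := W.v_pos J β
  rcases W.nestedOrDisjoint I α J β hne with h | h | h | h | h
  · exact ⟨_, fun x hx => W.haar_on1 (h hx)⟩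
  · exact ⟨_, fun x hx => W.haar_on2 (h hx)⟩
  · exfalso
    have := ENNReal.toReal_mono (W.top1 I α) (measure_mono (μ := volume) h)
    change (volume (W.E J β)).toReal ≤ W.v I α at this
    rw [volE] at this; linarith
  · exfalso
    have := ENNReal.toReal_mono (W.top2 I α) (measure_mono (μ := volume) h)
    change (volume (W.E J β)).toReal ≤ _ at this
    rw [volE, v_eq2] at this; linarith
  · exact ⟨0, fun x hx => W.haar_off (Set.disjoint_left.mp h hx)⟩

lemma orthonormal (p q : DyadicCube d × Gamma d) :
    ∫ x, W.haar p.1 p.2 x * W.haar q.1 q.2 x = if p = q then 1 else 0 := by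
  split_ifs with h
  · subst h
    simp_rw [haar_sq]
    exact W.integral_h1 _ _
  · rcases le_total (W.v p.1 p.2) (W.v q.1 q.2) with hv | hv
    · obtain ⟨c, hc⟩ := W.const_on_of_le (I := p.1) (α := p.2) (J := q.1) (β := q.2) h hv
      simp_rw [mul_comm (W.haar p.1 p.2 _)]
      exact W.integral_const_on hc
    · obtain ⟨c, hc⟩ := W.const_on_of_le (I := q.1) (α := q.2) (J := p.1) (β := p.2)
        (Ne.symm h) hv
      exact W.integral_const_on hc

lemma triple_aux (p q r : DyadicCube d × Gamma d) (hpr : p ≠ r) (hqr : q ≠ r)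
    (h1 : W.v r.1 r.2 ≤ W.v p.1 p.2) (h2 : W.v r.1 r.2 ≤ W.v q.1 q.2) :
    ∫ x, W.haar p.1 p.2 x * W.haar q.1 q.2 x * W.haar r.1 r.2 x = 0 := by
  obtain ⟨a, ha⟩ := W.const_on_of_le (I := r.1) (α := r.2) (J := p.1) (β := p.2) hpr.symm h1
  obtain ⟨b, hb⟩ := W.const_on_of_le (I := r.1) (α := r.2) (J := q.1) (β := q.2) hqr.symm h2
  exact W.integral_const_on (c := a * b) fun x hx => by rw [ha x hx, hb x hx]

lemma triple_distinct (p q r : DyadicCube d × Gamma d) (hpq : p ≠ q) (hpr : p ≠ r) (hqr : q ≠ r) :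
    ∫ x, W.haar p.1 p.2 x * W.haar q.1 q.2 x * W.haar r.1 r.2 x = 0 := by
  have c1 : (fun x => W.haar p.1 p.2 x * W.haar q.1 q.2 x * W.haar r.1 r.2 x) =
      fun x => W.haar q.1 q.2 x * W.haar r.1 r.2 x * W.haar p.1 p.2 x := by
    funext x; ring
  have c2 : (fun x => W.haar p.1 p.2 x * W.haar q.1 q.2 x * W.haar r.1 r.2 x) =
      fun x => W.haar p.1 p.2 x * W.haar r.1 r.2 x * W.haar q.1 q.2 x := by
    funext x; ring
  rcases le_total (W.v p.1 p.2) (W.v q.1 q.2) with a | a <;>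
  rcases le_total (W.v p.1 p.2) (W.v r.1 r.2) with b | b <;>
  rcases le_total (W.v q.1 q.2) (W.v r.1 r.2) with c | c
  · rw [c1]; exact W.triple_aux q r p hpq.symm hpr.symm a b
  · rw [c1]; exact W.triple_aux q r p hpq.symm hpr.symm a b
  · exact W.triple_aux p q r hpr hqr b (b.trans a)
  · exact W.triple_aux p q r hpr hqr b c
  · rw [c2]; exact W.triple_aux p r q hpq hqr.symm a c
  · exact W.triple_aux p q r hpr hqr (c.trans a) c
  · rw [c2]; exact W.triple_aux p r q hpq hqr.symm a c
  · exact W.triple_aux p q r hpr hqr b c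

lemma avg_eq (I α) (f : (Fin d → ℝ) → ℝ) : avg (W.E I α) f = ∫ x, h1 (W.E I α) x * f x := by
  unfold avg h1
  rw [← integral_indicator (W.measE I α), div_eq_inv_mul, ← integral_const_mul]
  congr 1
  funext x
  by_cases hx : x ∈ W.E I α <;> simp [hx]

/-- The index set of the sum in the product formula. -/
def idx (r : DyadicCube d × Gamma d) : Set (DyadicCube d × Gamma d) :=
  {q | q.1.toSet ⊆ r.1.toSet ∧ W.E q.1 q.2 ⊂ W.E r.1 r.2}

lemma h1_haar (p r : DyadicCube d × Gamma d) (hp : p ∉ W.idx r) :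
    ∫ x, h1 (W.E p.1 p.2) x * W.haar r.1 r.2 x = 0 := by
  have hsub : W.E r.1 r.2 ⊆ W.E p.1 p.2 →
      ∫ x, h1 (W.E p.1 p.2) x * W.haar r.1 r.2 x = 0 := fun h =>
    W.integral_const_on (c := ((volume (W.E p.1 p.2)).toReal)⁻¹) fun x hx => by
      simp [h1, h hx]
  by_cases hpr : p = r
  · subst hpr; exact hsub le_rfl
  have hstrict : W.E p.1 p.2 ⊂ W.E r.1 r.2 → False := fun h =>
    hp ⟨W.cube_subset (h.1.trans (W.E_subset _ _)), h⟩
  obtain ⟨C, -, hC⟩ := W.exists_child1 r.1 r.2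
  obtain ⟨D, -, hD⟩ := W.exists_child2 r.1 r.2
  obtain ⟨x, hx⟩ := C.toSet_nonempty
  obtain ⟨y, hy⟩ := D.toSet_nonempty
  rcases W.nestedOrDisjoint p.1 p.2 r.1 r.2 hpr with h | h | h | h | h
  · refine (hstrict ⟨fun z hz => Or.inl (h hz), fun h' => ?_⟩).elim
    exact Set.disjoint_left.mp (W.disj r.1 r.2) (h (h' (Or.inr (hD hy)))) (hD hy)
  · refine (hstrict ⟨fun z hz => Or.inr (h hz), fun h' => ?_⟩).elim
    exact Set.disjoint_left.mp (W.disj r.1 r.2) (hC hx) (h (h' (Or.inl (hC hx))))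
  · exact hsub fun z hz => Or.inl (h hz)
  · exact hsub fun z hz => Or.inr (h hz)
  · refine W.integral_const_on (c := 0) fun z hz => ?_
    have : z ∉ W.E p.1 p.2 := Set.disjoint_right.mp h hz
    simp [h1, this]

/-- The product formula for a pair of Haar functions. -/
lemma triple (p q r : DyadicCube d × Gamma d) :
    ∫ x, W.haar p.1 p.2 x * W.haar q.1 q.2 x * W.haar r.1 r.2 x =
      (if q = p then (1 : ℝ) else 0) * (∫ x, h1 (W.E p.1 p.2) x * W.haar r.1 r.2 x) +
      (if p = r then (1 : ℝ) else 0) * (∫ x, h1 (W.E r.1 r.2) x * W.haar q.1 q.2 x) +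
      (if q = r then (1 : ℝ) else 0) * (∫ x, h1 (W.E r.1 r.2) x * W.haar p.1 p.2 x) := by
  have h0 : ∀ s : DyadicCube d × Gamma d,
      ∫ x, h1 (W.E s.1 s.2) x * W.haar s.1 s.2 x = 0 := fun s =>
    W.h1_haar s s fun h => h.2.2 h.2.1
  by_cases hpq : q = p
  · subst hpq
    simp_rw [haar_sq]
    by_cases hqr : q = r
    · subst hqr; simp [h0]
    · simp [hqr]
  by_cases hpr : p = r
  · subst hpr
    have : (fun x => W.haar p.1 p.2 x * W.haar q.1 q.2 x * W.haar p.1 p.2 x) =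
        fun x => h1 (W.E p.1 p.2) x * W.haar q.1 q.2 x := by
      funext x; rw [← haar_sq]; ring
    simp [hpq, this]
  by_cases hqr : q = r
  · subst hqr
    have : (fun x => W.haar p.1 p.2 x * W.haar q.1 q.2 x * W.haar q.1 q.2 x) =
        fun x => h1 (W.E q.1 q.2) x * W.haar p.1 p.2 x := by
      funext x; rw [← haar_sq]; ring
    simp [hpq, hpr, this]
  · rw [W.triple_distinct p q r (Ne.symm hpq) hpr hqr]
    simp [hpq, hpr, hqr]

lemma hcoef_sum (F : Finset (DyadicCube d × Gamma d)) (c : DyadicCube d × Gamma d → ℝ)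
    (r : DyadicCube d × Gamma d) :
    W.hcoef (fun x => ∑ p ∈ F, c p * W.haar p.1 p.2 x) r.1 r.2 =
      ∑ p ∈ F, c p * (if p = r then (1 : ℝ) else 0) := by
  unfold hcoef
  simp_rw [Finset.sum_mul, mul_assoc]
  rw [integral_finsetSum]
  · simp_rw [integral_const_mul, orthonormal]
  · intro p _
    exact (W.int_mul_haar (W.haar_int _ _) _ _).const_mul _

lemma int_h1_haar (r p : DyadicCube d × Gamma d) :
    Integrable fun x => h1 (W.E r.1 r.2) x * W.haar p.1 p.2 x := by
  simp_rw [← haar_sq]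
  exact W.int_mul_haar (W.int_mul_haar (W.haar_int _ _) _ _) _ _

lemma avg_sum (F : Finset (DyadicCube d × Gamma d)) (c : DyadicCube d × Gamma d → ℝ)
    (r : DyadicCube d × Gamma d) :
    avg (W.E r.1 r.2) (fun x => ∑ p ∈ F, c p * W.haar p.1 p.2 x) =
      ∑ p ∈ F, c p * ∫ x, h1 (W.E r.1 r.2) x * W.haar p.1 p.2 x := by
  rw [avg_eq]
  simp_rw [Finset.mul_sum, mul_left_comm _ (c _)]
  rw [integral_finsetSum]
  · simp_rw [integral_const_mul]
  · intro p _
    exact (W.int_h1_haar _ _).const_mul _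

lemma hcoef_mul (F G : Finset (DyadicCube d × Gamma d)) (c e : DyadicCube d × Gamma d → ℝ)
    (r : DyadicCube d × Gamma d) :
    W.hcoef (fun x => (∑ p ∈ F, c p * W.haar p.1 p.2 x) * ∑ p ∈ G, e p * W.haar p.1 p.2 x)
        r.1 r.2 =
      ∑ p ∈ F, ∑ q ∈ G, c p * e q *
        ∫ x, W.haar p.1 p.2 x * W.haar q.1 q.2 x * W.haar r.1 r.2 x := by
  have hint : ∀ p q : DyadicCube d × Gamma d, Integrable fun x =>
      c p * e q * (W.haar p.1 p.2 x * W.haar q.1 q.2 x * W.haar r.1 r.2 x) := fun p q =>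
    (W.int_mul_haar (W.int_mul_haar (W.haar_int _ _) _ _) _ _).const_mul _
  have : (fun x => (∑ p ∈ F, c p * W.haar p.1 p.2 x) * (∑ p ∈ G, e p * W.haar p.1 p.2 x) *
      W.haar r.1 r.2 x) = fun x => ∑ p ∈ F, ∑ q ∈ G, c p * e q *
        (W.haar p.1 p.2 x * W.haar q.1 q.2 x * W.haar r.1 r.2 x) := by
    funext x
    rw [Finset.sum_mul_sum, Finset.sum_mul]
    refine Finset.sum_congr rfl fun p _ => ?_
    rw [Finset.sum_mul]
    refine Finset.sum_congr rfl fun q _ => ?_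
    ring
  unfold hcoef
  rw [this, integral_finsetSum _ fun p _ => integrable_finsetSum _ fun q _ => hint p q]
  refine Finset.sum_congr rfl fun p _ => ?_
  rw [integral_finsetSum _ fun q _ => hint p q]
  simp_rw [integral_const_mul]

lemma tsum_idx (F G : Finset (DyadicCube d × Gamma d)) (c e : DyadicCube d × Gamma d → ℝ)
    (r : DyadicCube d × Gamma d) :
    (∑' q : W.idx r,
        W.hcoef (fun x => ∑ p ∈ F, c p * W.haar p.1 p.2 x) q.1.1 q.1.2 *
          W.hcoef (fun x => ∑ p ∈ G, e p * W.haar p.1 p.2 x) q.1.1 q.1.2 *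
          ∫ x, h1 (W.E q.1.1 q.1.2) x * W.haar r.1 r.2 x) =
      ∑ p ∈ F, ∑ q ∈ G, c p * e q * ((if q = p then (1 : ℝ) else 0) *
        ∫ x, h1 (W.E p.1 p.2) x * W.haar r.1 r.2 x) := by
  rw [tsum_subtype (W.idx r) (fun q =>
    W.hcoef (fun x => ∑ p ∈ F, c p * W.haar p.1 p.2 x) q.1 q.2 *
      W.hcoef (fun x => ∑ p ∈ G, e p * W.haar p.1 p.2 x) q.1 q.2 *
      ∫ x, h1 (W.E q.1 q.2) x * W.haar r.1 r.2 x)]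
  rw [Set.indicator_eq_self.mpr]
  · rw [tsum_eq_sum (s := F)]
    · refine Finset.sum_congr rfl fun p hp => ?_
      rw [hcoef_sum, hcoef_sum, Finset.mul_sum, Finset.sum_mul]
      refine Finset.sum_congr rfl fun q _ => ?_
      have : ∑ p' ∈ F, c p' * (if p' = p then (1 : ℝ) else 0) = c p := by
        simp [hp]
      rw [this]; ring
    · intro p hp
      have : ∑ p' ∈ F, c p' * (if p' = p then (1 : ℝ) else 0) = 0 := by
        simp [hp]
      rw [hcoef_sum, this]; ring
  · intro p hp
    by_contra h
    exact hp (by simp only [W.h1_haar p r h, mul_zero])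

end WilsonSystem

/-- The product formula for Haar coefficients of a product of two
finite linear combinations of Wilson Haar functions. -/
theorem haar_coefficient_product_formula (d : ℕ) (W : WilsonSystem d)
    (F G : Finset (DyadicCube d × Gamma d)) (c e : DyadicCube d × Gamma d → ℝ)
    (J : DyadicCube d) (β : Gamma d) :
    W.hcoef
        (fun x => (∑ p ∈ F, c p * W.haar p.1 p.2 x) * ∑ p ∈ G, e p * W.haar p.1 p.2 x)
        J β =
      (∑' q : {q : DyadicCube d × Gamma d //
          q.1.toSet ⊆ J.toSet ∧ W.E q.1 q.2 ⊂ W.E J β},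
        W.hcoef (fun x => ∑ p ∈ F, c p * W.haar p.1 p.2 x) q.1.1 q.1.2 *
          W.hcoef (fun x => ∑ p ∈ G, e p * W.haar p.1 p.2 x) q.1.1 q.1.2 *
          ∫ x, h1 (W.E q.1.1 q.1.2) x * W.haar J β x) +
        W.hcoef (fun x => ∑ p ∈ F, c p * W.haar p.1 p.2 x) J β *
          avg (W.E J β) (fun x => ∑ p ∈ G, e p * W.haar p.1 p.2 x) +
        W.hcoef (fun x => ∑ p ∈ G, e p * W.haar p.1 p.2 x) J β *
          avg (W.E J β) (fun x => ∑ p ∈ F, c p * W.haar p.1 p.2 x) := by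
  have hT := W.tsum_idx F G c e (J, β)
  have hM := W.hcoef_mul F G c e (J, β)
  have hF := W.hcoef_sum F c (J, β)
  have hG := W.hcoef_sum G e (J, β)
  have hAF := W.avg_sum F c (J, β)
  have hAG := W.avg_sum G e (J, β)
  refine hM.trans ?_
  refine Eq.trans ?_ (congrArg₂ (· + ·) (congrArg₂ (· + ·) hT.symm
    (congrArg₂ (· * ·) hF.symm hAG.symm)) (congrArg₂ (· * ·) hG.symm hAF.symm))
  simp only []
  rw [mul_comm (∑ p ∈ G, _) (∑ p ∈ F, _), Finset.sum_mul_sum, Finset.sum_mul_sum,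
    ← Finset.sum_add_distrib, ← Finset.sum_add_distrib]
  refine Finset.sum_congr rfl fun p _ => ?_
  rw [← Finset.sum_add_distrib, ← Finset.sum_add_distrib]
  refine Finset.sum_congr rfl fun q _ => ?_
  have := W.triple p q (J, β)
  simp only [] at this
  rw [this]
  ring
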